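/- Let μ be an inhomogeneous Bernoulli product on Σ with weights (p_k) ⊂ (0,1). Define the lower and upper Hausdorff dimensions of μ by dim_*(μ) = inf{ dim(E) : E Borel, μ(E) > 0 } and dim^*(μ) = inf{ dim(E) : E Borel, μ(E) = 1 }. Then μ is exact-dimensional in the sense that dim_*(μ) = dim^*(μ) = liminf_{n→∞} (1/n) ∑_{k=1}^n h(p_k), where h(p) = −p log₂ p − (1−p) log₂(1−p); moreover this common value equals −τ'(1⁺), the negative of the right derivative at q = 1 of τ(q) = limsup_n (1/n)∑_{k=1}^n log₂(p_k^q + (1−p_k)^q). -/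

import Mathlib

open MeasureTheory Filter Set
open scoped Topology ENNReal NNReal Classical

/-- The metric on `Σ = {0,1}^ℕ` in which two sequences are at distance `2^{-n}`,
`n` being the first index where they differ. -/
noncomputable instance : MetricSpace (ℕ → Bool) := PiNat.metricSpace

/-- The cylinder of generation `n` containing `x`. -/
def cyl (x : ℕ → Bool) (n : ℕ) : Set (ℕ → Bool) := {y | ∀ i < n, y i = x i}

/-- `τ(p,q) = log₂(p^q + (1-p)^q)`, the `L^q`-spectrum of the homogeneous Bernoulli
product of parameter `p`. -/
noncomputable def tauP (p q : ℝ) : ℝ := Real.logb 2 (p ^ q + (1 - p) ^ q)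

/-- `τ_n(q) = (1/n) ∑_{k<n} log₂(p_k^q + (1-p_k)^q)`. -/
noncomputable def tauN (p : ℕ → ℝ) (n : ℕ) (q : ℝ) : ℝ :=
  (1 / n) * ∑ k ∈ Finset.range n, tauP (p k) q

/-- The `L^q`-spectrum `τ(q) = limsup_n τ_n(q)`. -/
noncomputable def tauLq (p : ℕ → ℝ) (q : ℝ) : ℝ :=
  Filter.limsup (fun n => tauN p n q) Filter.atTop

/-- `μ` is the inhomogeneous Bernoulli product with weights `p`:
`μ(I_{ε_1…ε_n}) = ∏_{j=1}^n p_j^{1-ε_j} (1-p_j)^{ε_j}`. -/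
def IsBernoulli (μ : Measure (ℕ → Bool)) (p : ℕ → ℝ) : Prop :=
  ∀ (n : ℕ) (ε : ℕ → Bool),
    μ (cyl ε n) = ENNReal.ofReal (∏ j ∈ Finset.range n, if ε j then 1 - p j else p j)

/-- `α_n(x) = -log μ(I_n(x)) / (n log 2)`. -/
noncomputable def alphaN (μ : Measure (ℕ → Bool)) (x : ℕ → Bool) (n : ℕ) : ℝ :=
  -Real.log (μ (cyl x n)).toReal / (n * Real.log 2)

/-- The local dimension `α(x) = liminf_n α_n(x)`. -/
noncomputable def alphaDim (μ : Measure (ℕ → Bool)) (x : ℕ → Bool) : ℝ :=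
  Filter.liminf (fun n => alphaN μ x n) Filter.atTop

/-- The Legendre transform `τ*(α) = inf_{q ∈ ℝ} (α q + τ(q))`. -/
noncomputable def tauStar (p : ℕ → ℝ) (α : ℝ) : ℝ := ⨅ q : ℝ, (α * q + tauLq p q)

/-- `τ` is finite (i.e. the defining `limsup` is a genuine finite limsup) on a
neighborhood of `q`. -/
def TauFiniteNear (p : ℕ → ℝ) (q : ℝ) : Prop :=
  ∃ δ > (0:ℝ), ∀ q' ∈ Set.Ioo (q - δ) (q + δ),
    BddAbove (Set.range fun n => tauN p n q') ∧ BddBelow (Set.range fun n => tauN p n q')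

noncomputable def hE (p : ℝ) : ℝ := -p * Real.logb 2 p - (1 - p) * Real.logb 2 (1 - p)

noncomputable def HN (p : ℕ → ℝ) (n : ℕ) : ℝ := (1 / (n:ℝ)) * ∑ k ∈ Finset.range n, hE (p k)

lemma exp_le_quad (x : ℝ) : Real.exp x ≤ 1 + x + x ^ 2 * Real.exp |x| := by
  have h := Complex.norm_exp_sub_sum_le_norm_mul_exp (x : ℂ) 2
  have e : Complex.exp (x:ℂ) - ∑ m ∈ Finset.range 2, (x:ℂ) ^ m / (m.factorial : ℂ)
      = ((Real.exp x - (1 + x) : ℝ) : ℂ) := by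
    simp [Finset.sum_range_succ]
  rw [e, Complex.norm_real, Complex.norm_real, Real.norm_eq_abs, Real.norm_eq_abs, sq_abs] at h
  linarith [le_abs_self (Real.exp x - (1 + x))]

lemma one_side {a t : ℝ} (h0 : 0 < a) (h1 : a < 1) (ht : |t| ≤ 1 / 2) :
    a ^ (1 + t) ≤ a + t * (a * Real.log a) + 16 * t ^ 2 := by
  have hl : Real.log a < 0 := Real.log_neg h0 h1
  have e1 : a ^ (1 + t) = a * Real.exp (t * Real.log a) := by
    rw [Real.rpow_add h0, Real.rpow_one, Real.rpow_def_of_pos h0, mul_comm (Real.log a)]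
  have h2 := exp_le_quad (t * Real.log a)
  have h3 : Real.exp |t * Real.log a| ≤ a ^ (-(1/2) : ℝ) := by
    rw [Real.rpow_def_of_pos h0, Real.exp_le_exp, abs_mul, abs_of_neg hl]
    nlinarith
  have h4 := Real.abs_log_mul_self_rpow_lt a (1/4) h0 h1.le (by norm_num)
  have h5 : (Real.log a * a ^ (1/4 : ℝ)) ^ 2 ≤ 16 := by
    rw [← sq_abs]
    have := abs_nonneg (Real.log a * a ^ (1/4 : ℝ))
    have h4' : |Real.log a * a ^ (1/4 : ℝ)| < 4 := by
      refine h4.trans_le (by norm_num)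
    nlinarith
  have h6 : a * a ^ (-(1/2) : ℝ) = (a ^ (1/4 : ℝ)) ^ 2 := by
    rw [← Real.rpow_natCast, ← Real.rpow_mul h0.le]
    nth_rw 1 [← Real.rpow_one a]
    rw [← Real.rpow_add h0]; norm_num
  rw [e1]
  calc a * Real.exp (t * Real.log a)
      ≤ a * (1 + t * Real.log a + (t * Real.log a) ^ 2 * a ^ (-(1/2) : ℝ)) := by
        gcongr
        refine h2.trans ?_
        gcongr
    _ = a + t * (a * Real.log a) + t ^ 2 * (Real.log a ^ 2 * (a * a ^ (-(1/2) : ℝ))) := by ring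
    _ ≤ _ := by
        rw [h6, ← mul_pow]
        nlinarith [sq_nonneg t]

lemma sum_le {a t : ℝ} (h0 : 0 < a) (h1 : a < 1) (ht : |t| ≤ 1 / 2) :
    a ^ (1 + t) + (1 - a) ^ (1 + t) ≤ Real.exp (-(t * Real.log 2) * hE a + 32 * t ^ 2) := by
  have A := one_side h0 h1 ht
  have B := one_side (a := 1 - a) (by linarith) (by linarith) ht
  have l2 : Real.log 2 ≠ 0 := (Real.log_pos (by norm_num)).ne'
  have e : -(t * Real.log 2) * hE a
      = t * (a * Real.log a) + t * ((1 - a) * Real.log (1 - a)) := by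
    unfold hE Real.logb; field_simp; ring
  have := Real.add_one_le_exp (-(t * Real.log 2) * hE a + 32 * t ^ 2)
  rw [e] at this ⊢
  linarith

lemma le_sum {a t : ℝ} (h0 : 0 < a) (h1 : a < 1) :
    Real.exp (-(t * Real.log 2) * hE a) ≤ a ^ (1 + t) + (1 - a) ^ (1 + t) := by
  have h1' : 0 < 1 - a := by linarith
  have l2 : Real.log 2 ≠ 0 := (Real.log_pos (by norm_num)).ne'
  have e : -(t * Real.log 2) * hE a
      = a * (t * Real.log a) + (1 - a) * (t * Real.log (1 - a)) := by
    unfold hE Real.logb; field_simp; ring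
  have := convexOn_exp.2 (mem_univ (t * Real.log a)) (mem_univ (t * Real.log (1 - a)))
    h0.le h1'.le (by ring)
  rw [e]
  simp only [smul_eq_mul] at this
  rw [Real.rpow_add h0, Real.rpow_add h1', Real.rpow_one, Real.rpow_one,
    Real.rpow_def_of_pos h0, Real.rpow_def_of_pos h1', mul_comm (Real.log a), 
    mul_comm (Real.log (1 - a))]
  exact this

lemma hE_nonneg {a : ℝ} (h0 : 0 < a) (h1 : a < 1) : 0 ≤ hE a := by
  have A := Real.logb_nonpos (b := 2) (by norm_num) h0.le h1.le
  have B := Real.logb_nonpos (b := 2) (x := 1 - a) (by norm_num) (by linarith) (by linarith)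
  unfold hE; nlinarith

lemma hE_le_one {a : ℝ} (h0 : 0 < a) (h1 : a < 1) : hE a ≤ 1 := by
  have h := le_sum (t := -1) h0 h1
  norm_num at h
  have l2 : 0 < Real.log 2 := Real.log_pos (by norm_num)
  have := (Real.le_log_iff_exp_le (by norm_num)).2 h
  nlinarith

lemma tauP_le {a t : ℝ} (h0 : 0 < a) (h1 : a < 1) (ht : |t| ≤ 1 / 2) :
    tauP a (1 + t) ≤ -t * hE a + 32 / Real.log 2 * t ^ 2 := by
  have l2 : 0 < Real.log 2 := Real.log_pos (by norm_num)
  have hs : 0 < a ^ (1 + t) + (1 - a) ^ (1 + t) :=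
    add_pos (Real.rpow_pos_of_pos h0 _) (Real.rpow_pos_of_pos (by linarith) _)
  have := (Real.log_le_iff_le_exp hs).2 (sum_le h0 h1 ht)
  unfold tauP Real.logb
  rw [div_le_iff₀ l2]
  refine this.trans (le_of_eq ?_)
  field_simp

lemma le_tauP {a t : ℝ} (h0 : 0 < a) (h1 : a < 1) :
    -t * hE a ≤ tauP a (1 + t) := by
  have l2 : 0 < Real.log 2 := Real.log_pos (by norm_num)
  have hs : 0 < a ^ (1 + t) + (1 - a) ^ (1 + t) :=
    add_pos (Real.rpow_pos_of_pos h0 _) (Real.rpow_pos_of_pos (by linarith) _)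
  have := (Real.le_log_iff_exp_le hs).2 (le_sum (t := t) h0 h1)
  unfold tauP Real.logb
  rw [le_div_iff₀ l2]
  linarith

lemma HN_nonneg {p : ℕ → ℝ} (hp : ∀ k, p k ∈ Set.Ioo (0:ℝ) 1) (n : ℕ) : 0 ≤ HN p n := by
  unfold HN
  have := Finset.sum_nonneg (s := Finset.range n) fun k _ => hE_nonneg (hp k).1 (hp k).2
  positivity

lemma HN_le_one {p : ℕ → ℝ} (hp : ∀ k, p k ∈ Set.Ioo (0:ℝ) 1) (n : ℕ) : HN p n ≤ 1 := by
  unfold HN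
  have hh := Finset.sum_le_sum (s := Finset.range n) fun k _ => hE_le_one (hp k).1 (hp k).2
  rcases Nat.eq_zero_or_pos n with rfl | hn
  · simp
  · have : (0:ℝ) < n := by exact_mod_cast hn
    rw [one_div, inv_mul_le_iff₀ this]
    simpa using hh

lemma le_tauN {p : ℕ → ℝ} (hp : ∀ k, p k ∈ Set.Ioo (0:ℝ) 1) (n : ℕ) (t : ℝ) :
    -t * HN p n ≤ tauN p n (1 + t) := by
  unfold HN tauN
  rw [mul_left_comm, Finset.mul_sum]
  gcongr with k _
  exact le_tauP (hp k).1 (hp k).2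

lemma tauN_le {p : ℕ → ℝ} (hp : ∀ k, p k ∈ Set.Ioo (0:ℝ) 1) (n : ℕ) {t : ℝ} (ht : |t| ≤ 1 / 2) :
    tauN p n (1 + t) ≤ -t * HN p n + 32 / Real.log 2 * t ^ 2 := by
  have l2 : 0 < Real.log 2 := Real.log_pos (by norm_num)
  unfold HN tauN
  have h : ∑ k ∈ Finset.range n, tauP (p k) (1 + t)
      ≤ ∑ k ∈ Finset.range n, (-t * hE (p k) + 32 / Real.log 2 * t ^ 2) :=
    Finset.sum_le_sum fun k _ => tauP_le (hp k).1 (hp k).2 ht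
  rw [Finset.sum_add_distrib, ← Finset.mul_sum, Finset.sum_const, Finset.card_range,
    nsmul_eq_mul] at h
  rcases Nat.eq_zero_or_pos n with rfl | hn
  · simp; positivity
  · have hn' : (0:ℝ) < n := by exact_mod_cast hn
    rw [one_div, inv_mul_le_iff₀ hn']
    refine h.trans (le_of_eq ?_)
    field_simp

lemma HN_bdd_ge {p : ℕ → ℝ} (hp : ∀ k, p k ∈ Set.Ioo (0:ℝ) 1) :
    IsBoundedUnder (· ≥ ·) atTop (HN p) := isBoundedUnder_of ⟨0, HN_nonneg hp⟩

lemma HN_cobdd {p : ℕ → ℝ} (hp : ∀ k, p k ∈ Set.Ioo (0:ℝ) 1) :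
    IsCoboundedUnder (· ≥ ·) atTop (HN p) :=
  IsBoundedUnder.isCoboundedUnder_ge (isBoundedUnder_of ⟨1, HN_le_one hp⟩)

lemma tau_sandwich {p : ℕ → ℝ} (hp : ∀ k, p k ∈ Set.Ioo (0:ℝ) 1) {t : ℝ} (h0 : 0 ≤ t)
    (ht : t ≤ 1 / 2) :
    -t * liminf (HN p) atTop ≤ tauLq p (1 + t) ∧
    tauLq p (1 + t) ≤ -t * liminf (HN p) atTop + 32 / Real.log 2 * t ^ 2 := by
  have ht' : |t| ≤ 1 / 2 := by rwa [abs_of_nonneg h0]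
  have b1 : IsBoundedUnder (· ≤ ·) atTop (fun n => tauN p n (1 + t)) :=
    isBoundedUnder_of ⟨32 / Real.log 2 * t ^ 2, fun n => (tauN_le hp n ht').trans (by
      nlinarith [HN_nonneg hp n])⟩
  have b2 : IsBoundedUnder (· ≥ ·) atTop (fun n => tauN p n (1 + t)) :=
    isBoundedUnder_of ⟨-t, fun n => le_trans (by nlinarith [HN_le_one hp n]) (le_tauN hp n t)⟩
  constructor
  · refine le_of_forall_pos_sub_le fun ε hε => ?_
    have hf := frequently_lt_of_liminf_lt (HN_cobdd hp)
      (show liminf (HN p) atTop < liminf (HN p) atTop + ε by linarith)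
    refine le_limsup_of_frequently_le (hf.mono fun n hn => ?_) b1
    refine le_trans ?_ (le_tauN hp n t)
    nlinarith
  · refine le_of_forall_pos_le_add fun ε hε => ?_
    have hf := eventually_lt_of_lt_liminf
      (show liminf (HN p) atTop - ε < liminf (HN p) atTop by linarith) (HN_bdd_ge hp)
    refine limsup_le_of_le b2.isCoboundedUnder_le (hf.mono fun n hn => ?_)
    refine (tauN_le hp n ht').trans ?_
    nlinarith

lemma part3 {p : ℕ → ℝ} (hp : ∀ k, p k ∈ Set.Ioo (0:ℝ) 1)
    (τr : ℝ) (hr : HasDerivWithinAt (tauLq p) τr (Set.Ici 1) 1) :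
    liminf (HN p) atTop = -τr := by
  have h1 : tauLq p 1 = 0 := by
    have := tau_sandwich hp (t := 0) le_rfl (by norm_num)
    simp at this
    exact le_antisymm this.2 this.1
  rw [hasDerivWithinAt_iff_tendsto_slope, Set.Ici_sdiff_left] at hr
  have hev : ∀ᶠ q in 𝓝[>] (1:ℝ), q ∈ Set.Ioo (1:ℝ) (3/2) :=
    Ioo_mem_nhdsGT (by norm_num)
  have hlim : Tendsto (slope (tauLq p) 1) (𝓝[>] 1) (𝓝 (-liminf (HN p) atTop)) := by
    have hu : Tendsto (fun q : ℝ => -liminf (HN p) atTop + 32 / Real.log 2 * (q - 1)) (𝓝[>] 1)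
        (𝓝 (-liminf (HN p) atTop)) := by
      have : Continuous (fun q : ℝ => -liminf (HN p) atTop + 32 / Real.log 2 * (q - 1)) := by
        fun_prop
      have := (this.tendsto 1).mono_left (nhdsWithin_le_nhds (s := Ioi 1))
      simpa using this
    refine tendsto_of_tendsto_of_tendsto_of_le_of_le' tendsto_const_nhds hu ?_ ?_
    · filter_upwards [hev] with q hq
      have := (tau_sandwich hp (t := q - 1) (by linarith [hq.1]) (by linarith [hq.2])).1
      rw [slope_def_field, h1, le_div_iff₀ (by linarith [hq.1])]
      rw [add_sub_cancel] at this
      linarith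
    · filter_upwards [hev] with q hq
      have := (tau_sandwich hp (t := q - 1) (by linarith [hq.1]) (by linarith [hq.2])).2
      rw [slope_def_field, h1, div_le_iff₀ (by linarith [hq.1])]
      rw [add_sub_cancel] at this
      linarith
  have := tendsto_nhds_unique hr hlim
  linarith

def res (n : ℕ) (x : ℕ → Bool) : Fin n → Bool := fun i => x i

def ext0 (n : ℕ) (w : Fin n → Bool) : ℕ → Bool := fun i => if h : i < n then w ⟨i, h⟩ else false

noncomputable def PW (p : ℕ → ℝ) (n : ℕ) (w : Fin n → Bool) : ℝ :=
  ∏ i : Fin n, if w i then 1 - p i else p i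

lemma res_ext0 (n : ℕ) (w : Fin n → Bool) : res n (ext0 n w) = w := by
  funext i; simp [res, ext0]

lemma cyl_eq (x : ℕ → Bool) (n : ℕ) : cyl x n = res n ⁻¹' {res n x} := by
  ext y
  simp only [cyl, res, Set.mem_ofPred_eq, mem_preimage, mem_singleton_iff, funext_iff]
  exact ⟨fun h i => h i i.2, fun h i hi => h ⟨i, hi⟩⟩

lemma measurable_res (n : ℕ) : Measurable (res n) :=
  measurable_pi_lambda _ fun _ => measurable_pi_apply _

lemma meas_pre (n : ℕ) (S : Set (Fin n → Bool)) : MeasurableSet (res n ⁻¹' S) :=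
  measurable_res n S.toFinite.measurableSet

lemma PW_pos {p : ℕ → ℝ} (hp : ∀ k, p k ∈ Set.Ioo (0:ℝ) 1) (n : ℕ) (w : Fin n → Bool) :
    0 < PW p n w := by
  refine Finset.prod_pos fun i _ => ?_
  have := hp i
  split_ifs
  · linarith [this.2]
  · exact this.1

lemma mu_cyl {p : ℕ → ℝ} {μ : Measure (ℕ → Bool)} (hμ : IsBernoulli μ p) (n : ℕ)
    (x : ℕ → Bool) : μ (cyl x n) = ENNReal.ofReal (PW p n (res n x)) := by
  rw [hμ n x, PW, Finset.prod_range]; rfl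

lemma mu_word {p : ℕ → ℝ} {μ : Measure (ℕ → Bool)} (hμ : IsBernoulli μ p) (n : ℕ)
    (w : Fin n → Bool) : μ (res n ⁻¹' {w}) = ENNReal.ofReal (PW p n w) := by
  have := mu_cyl hμ n (ext0 n w)
  rwa [cyl_eq, res_ext0] at this

lemma sum_PW {p : ℕ → ℝ} (hp : ∀ k, p k ∈ Set.Ioo (0:ℝ) 1) (n : ℕ) (q : ℝ) :
    ∑ w : Fin n → Bool, PW p n w ^ q
      = ∏ k ∈ Finset.range n, (p k ^ q + (1 - p k) ^ q) := by
  have h : ∀ w : Fin n → Bool, PW p n w ^ q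
      = ∏ i : Fin n, (if w i then (1 - p i) ^ q else p i ^ q) := by
    intro w
    unfold PW
    rw [← Real.finsetProd_rpow]
    · refine Finset.prod_congr rfl fun i _ => ?_
      split_ifs <;> rfl
    · intro i _
      have := hp i
      split_ifs
      · linarith [this.2]
      · exact this.1.le
  rw [Finset.prod_range]
  have e : ∀ i : Fin n, p i ^ q + (1 - p i) ^ q
      = ∑ b : Bool, (if b then (1 - p i) ^ q else p i ^ q) := by
    intro i; simp [add_comm]
  simp_rw [e, h]
  rw [Finset.prod_univ_sum, Fintype.piFinset_univ]

lemma mu_pre {p : ℕ → ℝ} {μ : Measure (ℕ → Bool)} (hμ : IsBernoulli μ p) (n : ℕ)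
    (S : Set (Fin n → Bool)) :
    μ (res n ⁻¹' S) ≤ ∑ w : Fin n → Bool, if w ∈ S then ENNReal.ofReal (PW p n w) else 0 := by
  have : res n ⁻¹' S ⊆ ⋃ w ∈ (Finset.univ.filter (fun w => w ∈ S)), res n ⁻¹' {w} := by
    intro x hx
    simp only [mem_iUnion]
    exact ⟨res n x, by simpa using hx, rfl⟩
  refine (measure_mono this).trans ((measure_biUnion_finset_le _ _).trans ?_)
  rw [Finset.sum_filter]
  refine Finset.sum_le_sum fun w _ => ?_
  split_ifs
  · exact (mu_word hμ n w).le
  · rfl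

/-- Chernoff bound -/
lemma chernoff {p : ℕ → ℝ} (hp : ∀ k, p k ∈ Set.Ioo (0:ℝ) 1)
    {μ : Measure (ℕ → Bool)} (hμ : IsBernoulli μ p) (n : ℕ) (S : Set (Fin n → Bool))
    (t s : ℝ) (ht : |t| ≤ 1 / 2)
    (hS : ∀ w ∈ S, 1 ≤ Real.exp (n * (s * t * Real.log 2)) * PW p n w ^ t) :
    μ (res n ⁻¹' S) ≤
      ENNReal.ofReal (Real.exp (n * (t * Real.log 2 * (s - HN p n) + 32 * t ^ 2))) := by
  refine (mu_pre hμ n S).trans ?_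
  have h1 : ∀ w : Fin n → Bool, (if w ∈ S then ENNReal.ofReal (PW p n w) else 0)
      ≤ ENNReal.ofReal (Real.exp (n * (s * t * Real.log 2)) * PW p n w ^ (1 + t)) := by
    intro w
    have hw := PW_pos hp n w
    split_ifs with h
    · apply ENNReal.ofReal_le_ofReal
      rw [Real.rpow_add hw, Real.rpow_one]
      have := hS w h
      nlinarith
    · exact zero_le
  refine (Finset.sum_le_sum fun w _ => h1 w).trans ?_
  rw [← ENNReal.ofReal_sum_of_nonneg]
  swap
  · intro w _
    have hw := PW_pos hp n w
    positivity
  apply ENNReal.ofReal_le_ofReal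
  rw [← Finset.mul_sum, sum_PW hp]
  have h2 : ∏ k ∈ Finset.range n, (p k ^ (1 + t) + (1 - p k) ^ (1 + t))
      ≤ ∏ k ∈ Finset.range n, Real.exp (-(t * Real.log 2) * hE (p k) + 32 * t ^ 2) := by
    refine Finset.prod_le_prod (fun k _ => ?_) fun k _ => sum_le (hp k).1 (hp k).2 ht
    exact (add_pos (Real.rpow_pos_of_pos (hp k).1 _)
      (Real.rpow_pos_of_pos (by linarith [(hp k).2]) _)).le
  rw [← Real.exp_sum, Finset.sum_add_distrib, ← Finset.mul_sum, Finset.sum_const,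
    Finset.card_range, nsmul_eq_mul] at h2
  refine (mul_le_mul_of_nonneg_left h2 (Real.exp_pos _).le).trans ?_
  rw [← Real.exp_add, Real.exp_le_exp]
  have : ∑ k ∈ Finset.range n, hE (p k) = n * HN p n := by
    unfold HN
    rcases Nat.eq_zero_or_pos n with rfl | hn
    · simp
    · have hn' : (n:ℝ) ≠ 0 := by positivity
      field_simp
  rw [this]
  apply le_of_eq; ring

lemma exists_t {δ : ℝ} (hδ : 0 < δ) : ∃ t : ℝ, 0 < t ∧ t ≤ 1 / 2 ∧ ∃ c > 0,
    ∀ u, δ ≤ u → - (t * Real.log 2 * u) + 32 * t ^ 2 ≤ - c := by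
  have l2 : 0 < Real.log 2 := Real.log_pos (by norm_num)
  refine ⟨min (1/2) (δ * Real.log 2 / 64), by positivity, min_le_left _ _,
    min (1/2) (δ * Real.log 2 / 64) * (δ * Real.log 2 / 2), by positivity, fun u hu => ?_⟩
  set t := min (1/2) (δ * Real.log 2 / 64)
  have h1 : t ≤ δ * Real.log 2 / 64 := min_le_right _ _
  have h0 : 0 < t := by positivity
  have : t * Real.log 2 * δ ≤ t * Real.log 2 * u := by gcongr
  nlinarith

/-- lower deviations: too heavy cylinders -/
lemma dev_low {p : ℕ → ℝ} (hp : ∀ k, p k ∈ Set.Ioo (0:ℝ) 1)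
    {μ : Measure (ℕ → Bool)} (hμ : IsBernoulli μ p) {δ : ℝ} (hδ : 0 < δ) :
    ∃ c > 0, ∀ n s, s + δ ≤ HN p n →
      μ (res n ⁻¹' {w | Real.exp (-(n * s * Real.log 2)) < PW p n w})
        ≤ ENNReal.ofReal (Real.exp (n * (-c))) := by
  obtain ⟨t, t0, t1, c, c0, h⟩ := exists_t hδ
  refine ⟨c, c0, fun n s hs => ?_⟩
  refine (chernoff hp hμ n _ t s (by rwa [abs_of_pos t0]) ?_).trans ?_
  · intro w hw
    have hw' : Real.exp (-(n * s * Real.log 2)) ^ t ≤ PW p n w ^ t :=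
      Real.rpow_le_rpow (Real.exp_pos _).le (le_of_lt hw) t0.le
    rw [← Real.exp_mul] at hw'
    calc (1:ℝ) = Real.exp (n * (s * t * Real.log 2)) * Real.exp (-(n * s * Real.log 2) * t) := by
          rw [← Real.exp_add, eq_comm, Real.exp_eq_one_iff]; ring
      _ ≤ _ := by gcongr
  · apply ENNReal.ofReal_le_ofReal
    rw [Real.exp_le_exp]
    have := h (HN p n - s) (by linarith)
    gcongr
    linarith

lemma dev_up {p : ℕ → ℝ} (hp : ∀ k, p k ∈ Set.Ioo (0:ℝ) 1)
    {μ : Measure (ℕ → Bool)} (hμ : IsBernoulli μ p) {δ : ℝ} (hδ : 0 < δ) :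
    ∃ c > 0, ∀ n s, HN p n + δ ≤ s →
      μ (res n ⁻¹' {w | PW p n w < Real.exp (-(n * s * Real.log 2))})
        ≤ ENNReal.ofReal (Real.exp (n * (-c))) := by
  obtain ⟨t, t0, t1, c, c0, h⟩ := exists_t hδ
  refine ⟨c, c0, fun n s hs => ?_⟩
  refine (chernoff hp hμ n _ (-t) s (by rwa [abs_neg, abs_of_pos t0]) ?_).trans ?_
  · intro w hw
    have hw' : Real.exp (-(n * s * Real.log 2)) ^ (-t) ≤ PW p n w ^ (-t) :=
      Real.rpow_le_rpow_of_nonpos (PW_pos hp n w) (le_of_lt hw) (by linarith)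
    rw [← Real.exp_mul] at hw'
    calc (1:ℝ) = Real.exp (n * (s * (-t) * Real.log 2)) * Real.exp (-(n * s * Real.log 2) * (-t)) := by
          rw [← Real.exp_add, eq_comm, Real.exp_eq_one_iff]; ring
      _ ≤ _ := by gcongr
  · apply ENNReal.ofReal_le_ofReal
    rw [Real.exp_le_exp]
    have := h (s - HN p n) (by linarith)
    gcongr
    linarith

instance borelSig : BorelSpace (ℕ → Bool) :=
  (Pi.borelSpace : @BorelSpace (ℕ → Bool) Pi.topologicalSpace MeasurableSpace.pi)

lemma res_eq_iff (n : ℕ) (x y : ℕ → Bool) : res n x = res n y ↔ dist x y ≤ (1/2) ^ n := by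
  have h := PiNat.mem_cylinder_iff_dist_le (E := fun _ => Bool) (x := y) (y := x) (n := n)
  refine Iff.trans ?_ h
  rw [PiNat.mem_cylinder_iff, funext_iff]
  exact ⟨fun h i hi => h ⟨i, hi⟩, fun h i => h i i.2⟩

lemma edist_le_iff (n : ℕ) (x y : ℕ → Bool) :
    res n x = res n y ↔ edist x y ≤ ENNReal.ofReal ((1/2) ^ n) := by
  rw [res_eq_iff, edist_dist, ENNReal.ofReal_le_ofReal_iff (by positivity)]

lemma half_pow_rpow (n : ℕ) (s : ℝ) :
    ((1/2 : ℝ) ^ n) ^ s = Real.exp (-(n * s * Real.log 2)) := by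
  rw [Real.rpow_def_of_pos (by positivity), Real.log_pow, one_div, Real.log_inv]
  congr 1; ring

lemma ediam_word (n : ℕ) (w : Fin n → Bool) :
    Metric.ediam (res n ⁻¹' {w}) ≤ ENNReal.ofReal ((1/2) ^ n) := by
  refine Metric.ediam_le fun x hx y hy => ?_
  rw [← edist_le_iff]
  exact hx.trans hy.symm

lemma tsum_exp_ne_top {c : ℝ} (hc : 0 < c) :
    ∑' n : ℕ, ENNReal.ofReal (Real.exp (n * (-c))) ≠ ∞ :=
  Summable.tsum_ofReal_ne_top (Real.summable_exp_nat_mul_iff.2 (by linarith))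

lemma tendsto_exp_zero {c : ℝ} (hc : 0 < c) :
    Tendsto (fun n : ℕ => ENNReal.ofReal (Real.exp (n * (-c)))) atTop (𝓝 0) :=
  ENNReal.tendsto_atTop_zero_of_tsum_ne_top (tsum_exp_ne_top hc)

lemma liminf_nonneg {p : ℕ → ℝ} (hp : ∀ k, p k ∈ Set.Ioo (0:ℝ) 1) :
    0 ≤ liminf (HN p) atTop :=
  le_liminf_of_le (HN_cobdd hp) (Eventually.of_forall (HN_nonneg hp))

lemma upper {p : ℕ → ℝ} (hp : ∀ k, p k ∈ Set.Ioo (0:ℝ) 1)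
    {μ : Measure (ℕ → Bool)} [IsProbabilityMeasure μ] (hμ : IsBernoulli μ p) {s : ℝ}
    (hs : liminf (HN p) atTop < s) :
    ∃ E, MeasurableSet E ∧ μ E = 1 ∧ dimH E ≤ ENNReal.ofReal s := by
  have l2 : 0 < Real.log 2 := Real.log_pos (by norm_num)
  have hL := liminf_nonneg hp
  set L := liminf (HN p) atTop with hLdef
  have hs0 : 0 < s := by linarith
  obtain ⟨δ, hδ⟩ : ∃ δ, δ = (s - L) / 3 := ⟨_, rfl⟩
  have δ0 : 0 < δ := by linarith
  obtain ⟨s1, hs1⟩ : ∃ s1, s1 = L + 2 * δ := ⟨_, rfl⟩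
  obtain ⟨c, c0, hc⟩ := dev_up hp hμ δ0
  set Bad : ℕ → Set (ℕ → Bool) :=
    fun n => res n ⁻¹' {w | PW p n w < Real.exp (-(n * s1 * Real.log 2))} with hBad
  have mB : ∀ n, MeasurableSet (Bad n) := fun n => meas_pre n _
  have hfreq : ∃ᶠ n in atTop, HN p n < L + δ :=
    frequently_lt_of_liminf_lt (HN_cobdd hp) (by linarith)
  have mE : MeasurableSet (⋃ N, ⋂ n ≥ N, Bad n) :=
    MeasurableSet.iUnion fun N => MeasurableSet.iInter fun n => MeasurableSet.iInter fun _ => mB n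
  refine ⟨(⋃ N, ⋂ n ≥ N, Bad n)ᶜ, mE.compl, ?_, ?_⟩
  · rw [prob_compl_eq_one_iff mE, measure_iUnion_null_iff]
    intro N
    have : μ (⋂ n ≥ N, Bad n) ≤ 0 := by
      refine ge_of_tendsto_of_frequently (tendsto_exp_zero c0)
        ((hfreq.and_eventually (eventually_ge_atTop N)).mono fun n hn => ?_)
      refine (measure_mono (iInter₂_subset n hn.2)).trans (hc n s1 ?_)
      linarith [hn.1]
    exact le_antisymm this zero_le
  · set E := (⋃ N, ⋂ n ≥ N, Bad n)ᶜ with hE'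
    let t : ∀ N : ℕ, (Σ n : ℕ, (Fin (n + N) → Bool)) → Set (ℕ → Bool) := fun N i =>
      if Real.exp (-((i.1 + N : ℕ) * s1 * Real.log 2)) ≤ PW p (i.1 + N) i.2 then
        res (i.1 + N) ⁻¹' {i.2} else ∅
    have hcov : ∀ N, E ⊆ ⋃ i, t N i := by
      intro N x hx
      have : ∃ n ≥ N, x ∉ Bad n := by
        by_contra! h
        exact hx (mem_iUnion.2 ⟨N, mem_iInter₂.2 h⟩)
      obtain ⟨n, hn, hxn⟩ := this
      obtain ⟨m, rfl⟩ := Nat.exists_eq_add_of_le' hn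
      refine mem_iUnion.2 ⟨⟨m, res (m + N) x⟩, ?_⟩
      have hx' : Real.exp (-((m + N : ℕ) * s1 * Real.log 2)) ≤ PW p (m + N) (res (m + N) x) :=
        not_lt.1 hxn
      simp only [t]
      rw [if_pos hx']
      rfl
    have hdi : ∀ N i, Metric.ediam (t N i) ≤ ENNReal.ofReal ((1/2) ^ N) := by
      intro N i
      simp only [t]
      split_ifs
      · refine (ediam_word _ _).trans (ENNReal.ofReal_le_ofReal ?_)
        exact pow_le_pow_of_le_one (by norm_num) (by norm_num) (by omega)
      · simp
    have hterm : ∀ N i, Metric.ediam (t N i) ^ s ≤ ENNReal.ofReal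
        (PW p (i.1 + N) i.2 * Real.exp ((i.1 + N : ℕ) * (-(δ * Real.log 2)))) := by
      intro N i
      simp only [t]
      split_ifs with h
      · refine (ENNReal.rpow_le_rpow (ediam_word _ _) hs0.le).trans ?_
        rw [ENNReal.ofReal_rpow_of_pos (by positivity), half_pow_rpow]
        apply ENNReal.ofReal_le_ofReal
        refine le_trans (le_of_eq ?_) (mul_le_mul_of_nonneg_right h (Real.exp_pos _).le)
        rw [← Real.exp_add]
        congr 1
        have : s = s1 + δ := by rw [hs1, hδ]; ring
        rw [this]; ring
      · simp [hs0]
    have hsum : ∀ N, ∑' i, Metric.ediam (t N i) ^ s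
        ≤ ∑' n : ℕ, ENNReal.ofReal (Real.exp ((n + N : ℕ) * (-(δ * Real.log 2)))) := by
      intro N
      refine (ENNReal.tsum_le_tsum (hterm N)).trans ?_
      rw [ENNReal.tsum_sigma']
      refine ENNReal.tsum_le_tsum fun n => ?_
      rw [tsum_fintype, ← ENNReal.ofReal_sum_of_nonneg]
      · apply ENNReal.ofReal_le_ofReal
        dsimp only
        rw [← Finset.sum_mul]
        have := sum_PW hp (n + N) 1
        simp only [Real.rpow_one, add_sub_cancel, Finset.prod_const_one] at this
        rw [this, one_mul]
      · intro w _
        have := PW_pos hp (n + N) w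
        positivity
    have hH : Measure.hausdorffMeasure s E ≤ 0 := by
      have hr : Tendsto (fun N : ℕ => ENNReal.ofReal ((1/2 : ℝ) ^ N)) atTop (𝓝 0) := by
        have := ENNReal.tendsto_ofReal
          (tendsto_pow_atTop_nhds_zero_of_lt_one (r := (1/2 : ℝ)) (by norm_num) (by norm_num))
        simpa using this
      refine (Measure.hausdorffMeasure_le_liminf_tsum s E _ hr t
        (Eventually.of_forall hdi) (Eventually.of_forall hcov)).trans ?_
      have h1 := ENNReal.tendsto_sum_nat_add _ (tsum_exp_ne_top (c := δ * Real.log 2) (by positivity))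
      exact (liminf_le_liminf (Eventually.of_forall hsum)).trans h1.liminf_eq.le
    have : dimH E ≤ (s.toNNReal : ℝ≥0∞) := by
      apply dimH_le_of_hausdorffMeasure_ne_top
      rw [Real.coe_toNNReal s hs0.le]
      exact (hH.trans_lt ENNReal.zero_lt_top).ne
    exact this

lemma lower {p : ℕ → ℝ} (hp : ∀ k, p k ∈ Set.Ioo (0:ℝ) 1)
    {μ : Measure (ℕ → Bool)} [IsProbabilityMeasure μ] (hμ : IsBernoulli μ p) {s : ℝ}
    (hs0 : 0 < s) (hs : s < liminf (HN p) atTop) {E : Set (ℕ → Bool)}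
    (hE : MeasurableSet E) (hpos : 0 < μ E) :
    ENNReal.ofReal s ≤ dimH E := by
  have l2 : 0 < Real.log 2 := Real.log_pos (by norm_num)
  set L := liminf (HN p) atTop with hLdef
  obtain ⟨δ, hδ⟩ : ∃ δ, δ = (L - s) / 2 := ⟨_, rfl⟩
  have δ0 : 0 < δ := by linarith
  obtain ⟨c, c0, hc⟩ := dev_low hp hμ δ0
  set Bad : ℕ → Set (ℕ → Bool) :=
    fun n => res n ⁻¹' {w | Real.exp (-(n * s * Real.log 2)) < PW p n w} with hBad
  have mB : ∀ n, MeasurableSet (Bad n) := fun n => meas_pre n _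
  obtain ⟨N0, hN0⟩ := eventually_atTop.1 (eventually_lt_of_lt_liminf
    (show s + δ < liminf (HN p) atTop by linarith) (HN_bdd_ge hp))
  have hae : ∀ᵐ x ∂μ, ∀ᶠ n in atTop, x ∉ Bad (n + N0) := by
    refine ae_eventually_notMem ?_
    refine ne_top_of_le_ne_top (tsum_exp_ne_top c0) ?_
    refine ENNReal.tsum_le_tsum fun n => (hc (n + N0) s (hN0 _ (by omega)).le).trans ?_
    apply ENNReal.ofReal_le_ofReal
    rw [Real.exp_le_exp]
    push_cast
    have : (0:ℝ) ≤ N0 := by positivity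
    nlinarith
  set G : ℕ → Set (ℕ → Bool) := fun M => ⋂ n ≥ M, (Bad n)ᶜ with hG
  have mG : ∀ M, MeasurableSet (G M) := fun M =>
    MeasurableSet.iInter fun n => MeasurableSet.iInter fun _ => (mB n).compl
  have hM : ∃ M, μ (E ∩ G M) ≠ 0 := by
    by_contra! h
    have h1 := measure_iUnion_null h
    have h2 : μ E ≤ μ (⋃ M, E ∩ G M) := by
      apply measure_mono_ae
      filter_upwards [hae] with x hx hxE
      obtain ⟨M, hM⟩ := eventually_atTop.1 hx
      refine mem_iUnion.2 ⟨M + N0, hxE, mem_iInter₂.2 fun n hn => ?_⟩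
      have := hM (n - N0) (by omega)
      rwa [Nat.sub_add_cancel (by omega)] at this
    rw [h1] at h2
    exact absurd hpos (not_lt.2 h2)
  obtain ⟨M, hM⟩ := hM
  have key : (ENNReal.ofReal (Real.exp (-(s * Real.log 2)))) • μ.restrict (G M)
      ≤ Measure.hausdorffMeasure s := by
    refine Measure.le_hausdorffMeasure s _ (ENNReal.ofReal ((1/2) ^ M))
      (ENNReal.ofReal_pos.2 (by positivity)) fun A hA => ?_
    rw [Measure.smul_apply, Measure.restrict_apply' (mG M), smul_eq_mul]
    rcases (A ∩ G M).eq_empty_or_nonempty with h | ⟨y, hyA, hyG⟩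
    · simp [h]
    have bd : ∀ n ≥ M, Metric.ediam A ≤ ENNReal.ofReal ((1/2) ^ n) →
        μ (A ∩ G M) ≤ ENNReal.ofReal (Real.exp (-(n * s * Real.log 2))) := by
      intro n hn hd
      have hsub : A ∩ G M ⊆ res n ⁻¹' {res n y} := by
        intro x hx
        exact (edist_le_iff n x y).2 ((Metric.edist_le_ediam_of_mem hx.1 hyA).trans hd)
      refine (measure_mono hsub).trans ?_
      rw [mu_word hμ]
      apply ENNReal.ofReal_le_ofReal
      exact not_lt.1 (mem_iInter₂.1 hyG n hn)
    rcases eq_or_ne (Metric.ediam A) 0 with h0 | h0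
    · have : μ (A ∩ G M) ≤ 0 := by
        refine ge_of_tendsto (tendsto_exp_zero (c := s * Real.log 2) (by positivity)) ?_
        filter_upwards [eventually_ge_atTop M] with n hn
        refine (bd n hn (by rw [h0]; exact zero_le)).trans (le_of_eq ?_)
        congr 2; ring
      rw [le_antisymm this zero_le, mul_zero]
      exact zero_le
    · have hfin : Metric.ediam A ≠ ∞ := ne_top_of_le_ne_top ENNReal.ofReal_ne_top hA
      obtain ⟨r, hr⟩ : ∃ r, r = (Metric.ediam A).toReal := ⟨_, rfl⟩
      have hr' : Metric.ediam A = ENNReal.ofReal r := by rw [hr, ENNReal.ofReal_toReal hfin]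
      have r0 : 0 < r := by rw [hr]; exact ENNReal.toReal_pos h0 hfin
      have rM : r ≤ (1/2) ^ M := by
        rwa [hr', ENNReal.ofReal_le_ofReal_iff (by positivity)] at hA
      obtain ⟨n, hn1, hn2⟩ := exists_nat_pow_near_of_lt_one r0
        (rM.trans (pow_le_one₀ (by norm_num) (by norm_num))) (show (0:ℝ) < 1/2 by norm_num)
        (by norm_num)
      have hnM : M ≤ n := by
        have := (pow_lt_pow_iff_right_of_lt_one₀ (show (0:ℝ) < 1/2 by norm_num)
          (by norm_num)).1 (hn1.trans_le rM)
        omega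
      have hb := bd n hnM (by rw [hr']; exact ENNReal.ofReal_le_ofReal hn2)
      rw [hr', ENNReal.ofReal_rpow_of_pos r0]
      calc ENNReal.ofReal (Real.exp (-(s * Real.log 2))) * μ (A ∩ G M)
          ≤ ENNReal.ofReal (Real.exp (-(s * Real.log 2)))
            * ENNReal.ofReal (Real.exp (-(n * s * Real.log 2))) := by gcongr
        _ = ENNReal.ofReal (((1/2) ^ (n+1)) ^ s) := by
            rw [← ENNReal.ofReal_mul (Real.exp_pos _).le, ← Real.exp_add, half_pow_rpow]
            congr 2; push_cast; ring
        _ ≤ _ := by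
            apply ENNReal.ofReal_le_ofReal
            exact Real.rpow_le_rpow (by positivity) hn1.le hs0.le
  have hne : Measure.hausdorffMeasure s E ≠ 0 := by
    intro h0
    have := key E
    rw [h0, Measure.smul_apply, Measure.restrict_apply hE, smul_eq_mul] at this
    rcases mul_eq_zero.1 (le_antisymm this zero_le) with h | h
    · exact absurd (ENNReal.ofReal_eq_zero.1 h) (not_le.2 (Real.exp_pos _))
    · exact hM h
  have : (s.toNNReal : ℝ≥0∞) ≤ dimH E := by
    apply le_dimH_of_hausdorffMeasure_ne_zero
    rwa [Real.coe_toNNReal s hs0.le]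
  exact this

lemma lower_all {p : ℕ → ℝ} (hp : ∀ k, p k ∈ Set.Ioo (0:ℝ) 1)
    {μ : Measure (ℕ → Bool)} [IsProbabilityMeasure μ] (hμ : IsBernoulli μ p)
    {E : Set (ℕ → Bool)} (hE : MeasurableSet E) (hpos : 0 < μ E) :
    ENNReal.ofReal (liminf (HN p) atTop) ≤ dimH E := by
  refine le_of_forall_lt fun a ha => ?_
  have ha' : a ≠ ∞ := ne_top_of_lt ha
  have h1 : a.toReal < liminf (HN p) atTop := by
    rw [← ENNReal.ofReal_toReal ha'] at ha
    exact (ENNReal.ofReal_lt_ofReal_iff_of_nonneg ENNReal.toReal_nonneg).1 ha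
  obtain ⟨s, h2, h3⟩ := exists_between h1
  have h4 := lower hp hμ (lt_of_le_of_lt ENNReal.toReal_nonneg h2) h3 hE hpos
  refine lt_of_lt_of_le ?_ h4
  rw [← ENNReal.ofReal_toReal ha']
  exact (ENNReal.ofReal_lt_ofReal_iff_of_nonneg ENNReal.toReal_nonneg).2 h2

lemma upper_all {p : ℕ → ℝ} (hp : ∀ k, p k ∈ Set.Ioo (0:ℝ) 1)
    {μ : Measure (ℕ → Bool)} [IsProbabilityMeasure μ] (hμ : IsBernoulli μ p) :
    sInf (dimH '' {E : Set (ℕ → Bool) | MeasurableSet E ∧ μ E = 1})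
      ≤ ENNReal.ofReal (liminf (HN p) atTop) := by
  refine ENNReal.le_of_forall_pos_le_add fun ε hε _ => ?_
  have hL := liminf_nonneg hp
  obtain ⟨E, h1, h2, h3⟩ := upper hp hμ
    (show liminf (HN p) atTop < liminf (HN p) atTop + ε by
      have : (0:ℝ) < ε := by exact_mod_cast hε
      linarith)
  refine (sInf_le (mem_image_of_mem dimH (show E ∈ {E | MeasurableSet E ∧ μ E = 1} from ⟨h1, h2⟩))).trans
    (h3.trans ?_)
  rw [ENNReal.ofReal_add hL ε.coe_nonneg, ENNReal.ofReal_coe_nnreal]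

/-- **Remark 2.2.** An inhomogeneous Bernoulli product is exact-dimensional:
`dim_*(μ) = dim^*(μ) = liminf_n (1/n) ∑_{k≤n} h(p_k) = -τ'(1⁺)`, where
`h(p) = -p log₂ p - (1-p) log₂(1-p)`. -/
theorem stmt8 (p : ℕ → ℝ) (hp : ∀ k, p k ∈ Set.Ioo (0:ℝ) 1)
    (μ : Measure (ℕ → Bool)) [IsProbabilityMeasure μ] (hμ : IsBernoulli μ p)
    (τr : ℝ) (hr : HasDerivWithinAt (tauLq p) τr (Set.Ici 1) 1) :
    sInf (dimH '' {E : Set (ℕ → Bool) | MeasurableSet E ∧ 0 < μ E})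
        = sInf (dimH '' {E : Set (ℕ → Bool) | MeasurableSet E ∧ μ E = 1}) ∧
    sInf (dimH '' {E : Set (ℕ → Bool) | MeasurableSet E ∧ 0 < μ E})
        = ENNReal.ofReal
            (Filter.liminf
              (fun n : ℕ => (1 / (n:ℝ)) * ∑ k ∈ Finset.range n,
                (-(p k) * Real.logb 2 (p k) - (1 - p k) * Real.logb 2 (1 - p k)))
              Filter.atTop) ∧
    Filter.liminf
        (fun n : ℕ => (1 / (n:ℝ)) * ∑ k ∈ Finset.range n,
          (-(p k) * Real.logb 2 (p k) - (1 - p k) * Real.logb 2 (1 - p k)))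
        Filter.atTop = -τr := by
  have e : (fun n : ℕ => (1 / (n:ℝ)) * ∑ k ∈ Finset.range n,
      (-(p k) * Real.logb 2 (p k) - (1 - p k) * Real.logb 2 (1 - p k))) = HN p := rfl
  rw [e]
  have hU := upper_all hp hμ
  have hLo : ENNReal.ofReal (liminf (HN p) atTop)
      ≤ sInf (dimH '' {E : Set (ℕ → Bool) | MeasurableSet E ∧ 0 < μ E}) := by
    refine le_sInf ?_
    rintro _ ⟨E, ⟨h1, h2⟩, rfl⟩
    exact lower_all hp hμ h1 h2
  have hm : sInf (dimH '' {E : Set (ℕ → Bool) | MeasurableSet E ∧ 0 < μ E})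
      ≤ sInf (dimH '' {E : Set (ℕ → Bool) | MeasurableSet E ∧ μ E = 1}) := by
    refine sInf_le_sInf (image_mono ?_)
    rintro E ⟨h1, h2⟩
    exact ⟨h1, by rw [h2]; exact one_pos⟩
  exact ⟨le_antisymm hm (hU.trans hLo), le_antisymm (hm.trans hU) hLo, part3 hp τr hr⟩
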